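/- Let n be a positive integer and let q_1, …, q_{n+1} be positive integers such that 2q_j divides q_{j+1} for j = 1, …, n. Let p be an integer coprime to q_{n+1} and let x ∈ 𝕋 be irrational (i.e., x is the class of an irrational real number). Then #{k ∈ {1, …, q_{n+1}} : m_n(x + k·p/q_{n+1}) = m_n(x)} = (q_{n+1}/2^n)·C(n, (n + m_n(x))/2), where n + m_n(x) is even and C(n, i) denotes the binomial coefficient. -/

import Mathlib

open MeasureTheory

/-- The Haar function `T : 𝕋 → ℤ`, equal to `1` on `[0,1/2)` and `-1` on `[1/2,1)`. -/
noncomputable def haarT (x : UnitAddCircle) : ℤ :=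
  if (AddCircle.equivIco 1 0 x : ℝ) < 1/2 then 1 else -1

/-- `m_n(x) = T(q_1 x) + ⋯ + T(q_n x)` (here `q j`, `j < n`, stands for the paper's `q_{j+1}`). -/
noncomputable def mSum (q : ℕ → ℕ) (n : ℕ) (x : UnitAddCircle) : ℤ :=
  ∑ j ∈ Finset.range n, haarT (q j • x)

lemma haarT_coe (x : ℝ) : haarT (x : UnitAddCircle) = if Int.fract x < 1 / 2 then 1 else -1 := by
  rw [haarT, AddCircle.coe_equivIco_mk_apply]
  simp

lemma haarT_eq_one_or_neg_one (y : UnitAddCircle) : haarT y = 1 ∨ haarT y = -1 := by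
  unfold haarT
  split_ifs <;> simp

lemma haarT_add_half (y : UnitAddCircle) :
    haarT (y + ((1 / 2 : ℝ) : UnitAddCircle)) = -haarT y := by
  induction y using QuotientAddGroup.induction_on with
  | H x =>
    change haarT ((x : UnitAddCircle) + ((1 / 2 : ℝ) : UnitAddCircle)) = -haarT (x : UnitAddCircle)
    rw [← AddCircle.coe_add, haarT_coe, haarT_coe]
    have h0 := Int.fract_nonneg x
    have h1 := Int.fract_lt_one x
    have hx := Int.floor_add_fract x
    by_cases h : Int.fract x < 1 / 2
    · have : Int.fract (x + 1 / 2) = Int.fract x + 1 / 2 :=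
        Int.fract_eq_iff.2 ⟨by linarith, by linarith, ⌊x⌋, by linarith⟩
      rw [if_pos h, if_neg (by linarith)]
    · have : Int.fract (x + 1 / 2) = Int.fract x - 1 / 2 :=
        Int.fract_eq_iff.2 ⟨by linarith, by linarith, ⌊x⌋ + 1, by push_cast; linarith⟩
      rw [if_neg h, if_pos (by linarith), neg_neg]

lemma sum_range_mul_eq {R : Type*} [AddCommMonoid R] (g : ℕ → R) (b m : ℕ) :
    ∑ k ∈ Finset.range (b * m), g k
      = ∑ a ∈ Finset.range b, ∑ l ∈ Finset.range m, g (b * l + a) := by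
  rw [Finset.sum_comm]
  induction m with
  | zero => simp
  | succ m ih => rw [Nat.mul_succ, Finset.sum_range_add, ih, Finset.sum_range_succ]

lemma coe_add_intCast (x : ℝ) (m : ℤ) : ((x + m : ℝ) : UnitAddCircle) = (x : UnitAddCircle) := by
  rw [AddCircle.coe_add, add_eq_left, AddCircle.coe_eq_zero_iff]
  exact ⟨m, by simp⟩

/-- For odd `p` the points `y + a p / (2 d)` and `y + (a + d) p / (2 d)` are antipodal,
so `f` has the average value `c / 2` along this orbit. -/
lemma sum_orbit_of_add_half {R : Type*} [CommSemiring R] (f : UnitAddCircle → R) (c : R)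
    (hf : ∀ y, f y + f (y + ((1 / 2 : ℝ) : UnitAddCircle)) = c) {p : ℤ} (hp : Odd p)
    {d : ℕ} (hd : 0 < d) (y : UnitAddCircle) :
    ∑ a ∈ Finset.range (2 * d), f (y + ((a * p / (2 * d) : ℝ) : UnitAddCircle)) = d * c := by
  rw [two_mul, Finset.sum_range_add, ← Finset.sum_add_distrib]
  rw [Finset.sum_congr rfl (g := fun _ => c), Finset.sum_const, Finset.card_range, nsmul_eq_mul]
  intro a _
  rw [← hf (y + ((a * p / (2 * d) : ℝ) : UnitAddCircle)), add_assoc y, ← AddCircle.coe_add]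
  obtain ⟨r, rfl⟩ := hp
  congr 3
  rw [← coe_add_intCast (_ + 1 / 2) r]
  congr 1
  push_cast
  field_simp
  ring

lemma sum_prod_orbit {R : Type*} [CommSemiring R] (f : UnitAddCircle → R) (c : R)
    (hf : ∀ y, f y + f (y + ((1 / 2 : ℝ) : UnitAddCircle)) = c) {p : ℤ} (hp : Odd p)
    (q : ℕ → ℕ) (n : ℕ) (hq : ∀ j ≤ n, 0 < q j) (hdvd : ∀ j < n, 2 * q j ∣ q (j + 1))
    (y : UnitAddCircle) :
    (∑ k ∈ Finset.range (q n), ∏ j ∈ Finset.range n,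
      f (q j • (y + ((k * p / q n : ℝ) : UnitAddCircle)))) * 2 ^ n = q n * c ^ n := by
  induction n generalizing y with
  | zero => simp
  | succ n ih =>
    obtain ⟨d, hd⟩ := hdvd n n.lt_succ_self
    have hqn := hq n n.le_succ
    have hd0 : 0 < d := Nat.pos_of_ne_zero fun h => by
      have := hq (n + 1) le_rfl
      simp [hd, h] at this
    have ih' := ih (fun j hj => hq j (hj.trans n.le_succ)) fun j hj => hdvd j (hj.trans n.lt_succ_self)
    have hqn' : (q n : ℝ) ≠ 0 := by positivity
    have hd' : (d : ℝ) ≠ 0 := by positivity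
    have split (a l : ℕ) : y + ((((2 * d * l + a : ℕ) : ℝ) * p / q (n + 1) : ℝ) : UnitAddCircle)
        = (y + ((a * p / q (n + 1) : ℝ) : UnitAddCircle))
          + ((l * p / q n : ℝ) : UnitAddCircle) := by
      rw [add_assoc, ← AddCircle.coe_add, hd]
      congr 2
      push_cast
      field_simp
      ring
    have last (a l : ℕ) : q n • ((y + ((a * p / q (n + 1) : ℝ) : UnitAddCircle))
          + ((l * p / q n : ℝ) : UnitAddCircle))
        = q n • y + ((a * p / (2 * d) : ℝ) : UnitAddCircle) := by
      rw [add_assoc, smul_add, ← AddCircle.coe_add, ← AddCircle.coe_nsmul,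
        ← coe_add_intCast (a * p / (2 * d)) (l * p), hd]
      congr 2
      push_cast
      rw [nsmul_eq_mul]
      field_simp
    calc _ = (∑ a ∈ Finset.range (2 * d), ∑ l ∈ Finset.range (q n),
            (∏ j ∈ Finset.range n, f (q j • ((y + ((a * p / q (n + 1) : ℝ) : UnitAddCircle))
              + ((l * p / q n : ℝ) : UnitAddCircle))))
            * f (q n • y + ((a * p / (2 * d) : ℝ) : UnitAddCircle))) * 2 ^ (n + 1) := by
          rw [← Finset.sum_congr rfl fun a _ => Finset.sum_congr rfl fun l _ => by
            rw [← last a l, ← Finset.prod_range_succ, ← split a l]]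
          rw [← sum_range_mul_eq (fun k => ∏ j ∈ Finset.range (n + 1),
            f (q j • (y + ((k * p / q (n + 1) : ℝ) : UnitAddCircle)))) (2 * d) (q n)]
          rw [show 2 * d * q n = q (n + 1) by rw [hd]; ring]
      _ = (∑ a ∈ Finset.range (2 * d), (q n * c ^ n)
            * f (q n • y + ((a * p / (2 * d) : ℝ) : UnitAddCircle))) * 2 := by
          rw [pow_succ, ← mul_assoc, Finset.sum_mul]
          congr 1
          refine Finset.sum_congr rfl fun a _ => ?_
          rw [← Finset.sum_mul, mul_right_comm, ih']
      _ = _ := by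
          rw [← Finset.mul_sum, sum_orbit_of_add_half f c hf hp hd0, hd]
          push_cast
          ring

/-- The number of `j < n` with `T(q_j x) = 1`. -/
noncomputable def plusCount (q : ℕ → ℕ) (n : ℕ) (x : UnitAddCircle) : ℕ :=
  {j ∈ Finset.range n | haarT (q j • x) = 1}.card

lemma add_mSum_eq_two_mul_plusCount (q : ℕ → ℕ) (n : ℕ) (x : UnitAddCircle) :
    (n : ℤ) + mSum q n x = 2 * plusCount q n x := by
  have h : ∀ j ∈ Finset.range n, haarT (q j • x) = 2 * (if haarT (q j • x) = 1 then 1 else 0) - 1 := by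
    intro j _
    rcases haarT_eq_one_or_neg_one (q j • x) with h | h <;> simp [h]
  rw [mSum, Finset.sum_congr rfl h, Finset.sum_sub_distrib, ← Finset.mul_sum, plusCount,
    Finset.sum_boole]
  simp

lemma card_plusCount_eq {p : ℤ} (hp : Odd p) (q : ℕ → ℕ) (n : ℕ) (hq : ∀ j ≤ n, 0 < q j)
    (hdvd : ∀ j < n, 2 * q j ∣ q (j + 1)) (y : UnitAddCircle) (i : ℕ) :
    ((Finset.range (q n)).filter fun k : ℕ =>
      plusCount q n (y + (((k : ℝ) * p / q n : ℝ) : UnitAddCircle)) = i).card * 2 ^ n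
      = q n * n.choose i := by
  have key := sum_prod_orbit (fun y => if haarT y = 1 then (Polynomial.X : Polynomial ℕ) else 1)
    (1 + Polynomial.X) (fun y => by
    rw [haarT_add_half]
    rcases haarT_eq_one_or_neg_one y with h | h <;> simp [h, add_comm])
    hp q n hq hdvd y
  have key := congrArg (fun P => Polynomial.coeff P i) key
  simp only [Finset.prod_ite, Finset.prod_const, one_pow, mul_one] at key
  have h2 : (2 : Polynomial ℕ) ^ n = ((2 ^ n : ℕ) : Polynomial ℕ) := by push_cast; rfl
  rw [h2, Polynomial.coeff_mul_natCast, Polynomial.coeff_natCast_mul,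
    Polynomial.coeff_one_add_X_pow, Polynomial.finsetSum_coeff] at key
  simp only [Polynomial.coeff_X_pow, Finset.sum_boole] at key
  simpa [plusCount, eq_comm] using key

/-- for positive integers `q_1, …, q_{n+1}` (here `q j` is the paper's `q_{j+1}`,
so `q n` is the paper's `q_{n+1}`) with `2q_j ∣ q_{j+1}`, an integer `p` coprime to `q_{n+1}`,
and an irrational `x`, the number `n + m_n(x)` is even, say `n + m_n(x) = 2i`, and
`#{k ∈ {1, …, q_{n+1}} : m_n(x + k·p/q_{n+1}) = m_n(x)} = (q_{n+1}/2^n)·C(n, i)`. -/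
theorem statement9 (n : ℕ) (hn : 0 < n) (q : ℕ → ℕ) (hq : ∀ j ≤ n, 0 < q j)
    (hdvd : ∀ j < n, 2 * q j ∣ q (j + 1))
    (p : ℤ) (hp : IsCoprime p (q n : ℤ))
    (x₀ : ℝ) (hx : Irrational x₀) :
    ∃ i : ℕ, (n : ℤ) + mSum q n (x₀ : UnitAddCircle) = 2 * i ∧
      {k : ℕ | k ∈ Finset.Icc 1 (q n) ∧
          mSum q n ((x₀ : UnitAddCircle) + (((k : ℝ) * (p : ℝ) / (q n : ℝ) : ℝ) : UnitAddCircle))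
            = mSum q n (x₀ : UnitAddCircle)}.ncard * 2 ^ n
        = q n * Nat.choose n i := by
  have hodd : Odd p := by
    have h2 : (2 : ℤ) ∣ q n := by
      obtain ⟨m, rfl⟩ := Nat.exists_eq_succ_of_ne_zero hn.ne'
      exact_mod_cast (dvd_mul_right 2 (q m)).trans (hdvd m m.lt_succ_self)
    exact Int.isCoprime_two_right.1 (hp.of_isCoprime_of_dvd_right h2)
  refine ⟨plusCount q n x₀, add_mSum_eq_two_mul_plusCount q n x₀, ?_⟩
  rw [← card_plusCount_eq hodd q n hq hdvd
    ((x₀ : UnitAddCircle) + ((p / q n : ℝ) : UnitAddCircle))]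
  congr 1
  rw [← Finset.card_image_of_injective _ (add_left_injective 1), ← Set.ncard_coe_finset]
  refine congrArg Set.ncard ?_
  ext k
  have hm (y : UnitAddCircle) : mSum q n y = mSum q n x₀ ↔ plusCount q n y = plusCount q n x₀ := by
    have h1 := add_mSum_eq_two_mul_plusCount q n y
    have h2 := add_mSum_eq_two_mul_plusCount q n x₀
    omega
  have shift (a : ℕ) : (x₀ : UnitAddCircle) + ((p / q n : ℝ) : UnitAddCircle)
      + ((a * p / q n : ℝ) : UnitAddCircle)
      = x₀ + ((((a + 1 : ℕ) : ℝ) * p / q n : ℝ) : UnitAddCircle) := by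
    rw [add_assoc, ← AddCircle.coe_add]
    congr 2
    push_cast
    ring
  simp only [hm, shift, Set.mem_ofPred_eq, Finset.coe_image, Finset.coe_filter, Set.mem_image,
    Finset.mem_range, Finset.mem_Icc]
  constructor
  · rintro ⟨⟨hk1, hk2⟩, hk⟩
    obtain ⟨a, rfl⟩ := Nat.exists_eq_add_of_le' hk1
    exact ⟨a, ⟨by omega, hk⟩, rfl⟩
  · rintro ⟨a, ⟨ha, hk⟩, rfl⟩
    exact ⟨⟨by omega, by omega⟩, hk⟩
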